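/- Let p be an odd prime and m ≥ 1 an integer with p ∤ m. Then q^{Σ_{j∈R_p(m)}(p−⟨jm⟩_p)}·(q^m;q^m)_{(p−1)/2}/(q;q)_{(p−1)/2} ≡ (m/p) (mod [p]_q). -/

import Mathlib

open Polynomial Finset

/-- The indeterminate `q` as an element of the rational function field `ℚ(q)`. -/
noncomputable def q : RatFunc ℚ := algebraMap (Polynomial ℚ) (RatFunc ℚ) Polynomial.X

/-- The `q`-integer `[n]_a = 1 + a + ⋯ + a^(n-1)` with base `a ∈ ℚ(q)`. -/
noncomputable def qn (a : RatFunc ℚ) (n : ℕ) : RatFunc ℚ := ∑ i ∈ Finset.range n, a ^ i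

/-- The `q`-Pochhammer symbol `(x; a)_n = ∏_{i=0}^{n-1} (1 - x a^i)`. -/
noncomputable def qpoch (x a : RatFunc ℚ) (n : ℕ) : RatFunc ℚ :=
  ∏ i ∈ Finset.range n, (1 - x * a ^ i)

/-- The Gaussian binomial coefficient `[n choose k]_a = (a;a)_n / ((a;a)_k (a;a)_{n-k})`. -/
noncomputable def qbinom (a : RatFunc ℚ) (n k : ℕ) : RatFunc ℚ :=
  qpoch a a n / (qpoch a a k * qpoch a a (n - k))

/-- The polynomial `q`-integer `[n]_a = 1 + a + ⋯ + a^(n-1)` with base `a ∈ ℚ[q]`. -/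
noncomputable def pqn (a : Polynomial ℚ) (n : ℕ) : Polynomial ℚ := ∑ i ∈ Finset.range n, a ^ i

/-- `A ≡ B (mod g)`: the rational function `(A - B)/g`, written in lowest terms,
has denominator coprime to `g`. -/
def qCong (g : Polynomial ℚ) (A B : RatFunc ℚ) : Prop :=
  IsCoprime (((A - B) / algebraMap (Polynomial ℚ) (RatFunc ℚ) g).denom) g

/-- The `q`-Fermat quotient `Q_p(m, a) = ((a^m; a^m)_{p-1} / (a; a)_{p-1} - 1) / [p]_a`. -/
noncomputable def QF (p m : ℕ) (a : RatFunc ℚ) : RatFunc ℚ :=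
  (qpoch (a ^ m) (a ^ m) (p - 1) / qpoch a a (p - 1) - 1) / qn a p

/-- `⟨x⟩_p`: the least non-negative residue of the integer `x` modulo `p`. -/
def res (p : ℕ) (x : ℤ) : ℕ := (x % (p : ℤ)).toNat

/-- `R_p(m) = {j : 1 ≤ j < p/2, ⟨jm⟩_p > p/2}` (for odd `p`, `1 ≤ j < p/2` means
`1 ≤ j ≤ (p-1)/2`, and `⟨jm⟩_p > p/2` means `2⟨jm⟩_p > p`). -/
def Rset (p : ℕ) (m : ℤ) : Finset ℕ :=
  (Finset.Icc 1 ((p - 1) / 2)).filter fun j => p < 2 * res p ((j : ℤ) * m)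

theorem coe_res (p : ℕ) [NeZero p] (x : ℤ) : res p x = (x : ZMod p).val := by
  have h := ZMod.val_intCast (n := p) x
  rw [res, ← h, Int.toNat_natCast]

theorem res_lt (p : ℕ) [NeZero p] (x : ℤ) : res p x < p := by
  rw [coe_res]
  exact ZMod.val_lt _

theorem qpoch_self (a : RatFunc ℚ) (n : ℕ) :
    qpoch a a n = ∏ j ∈ Icc 1 n, (1 - a ^ j) := by
  rw [qpoch, ← Finset.Ico_add_one_right_eq_Icc, Finset.prod_Ico_eq_prod_range]
  refine Finset.prod_congr rfl fun i _ => ?_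
  rw [pow_add, pow_one]

/-- A `q`-analogue of Gauss's lemma, valid at any `p`-th root of unity. -/
theorem gauss_lemma_of_pow_eq_one {R : Type*} [CommRing R] (p : ℕ) [Fact p.Prime] (hodd : Odd p)
    (m : ℕ) (hpm : ¬ p ∣ m) (x : R) (hx : x ^ p = 1) :
    x ^ (∑ j ∈ Rset p (m : ℤ), (p - res p ((j : ℤ) * m))) *
        ∏ j ∈ Icc 1 ((p - 1) / 2), (1 - (x ^ m) ^ j) =
      (legendreSym p m : R) * ∏ j ∈ Icc 1 ((p - 1) / 2), (1 - x ^ j) := by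
  have hp2 : p ≠ 2 := by rintro rfl; exact absurd hodd (by decide)
  have hhalf : (p - 1) / 2 = p / 2 := by obtain ⟨k, rfl⟩ := hodd; omega
  have hm0 : ((m : ℤ) : ZMod p) ≠ 0 := by
    simpa [CharP.cast_eq_zero_iff (ZMod p) p] using hpm
  have hIcc : Icc 1 ((p - 1) / 2) = Ico 1 (p / 2).succ := by
    rw [hhalf]; ext; simp
  have hres (j : ℕ) : res p ((j : ℤ) * m) = (((m : ℤ) : ZMod p) * (j : ZMod p)).val := by
    rw [coe_res]; push_cast; rw [mul_comm]
  have hhalf_lt (r : ℕ) : p < 2 * r ↔ p / 2 < r := by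
    obtain ⟨k, rfl⟩ := hodd; omega
  have hpow (j : ℕ) : (x ^ m) ^ j = x ^ res p ((j : ℤ) * m) := by
    rw [← pow_mul, pow_eq_pow_mod _ hx, mul_comm m j, res]
    norm_cast
  have habs (j : ℕ) : (((m : ℤ) : ZMod p) * (j : ZMod p)).valMinAbs.natAbs =
      if p < 2 * res p ((j : ℤ) * m) then p - res p ((j : ℤ) * m) else res p ((j : ℤ) * m) := by
    have hlt := res_lt p ((j : ℤ) * m)
    have hiff := hhalf_lt (res p ((j : ℤ) * m))
    rw [ZMod.valMinAbs_def_pos, ← hres]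
    split_ifs <;> omega
  have hfactor (j : ℕ) :
      (if p < 2 * res p ((j : ℤ) * m) then x ^ (p - res p ((j : ℤ) * m)) else 1) *
        (1 - (x ^ m) ^ j) =
      (if p < 2 * res p ((j : ℤ) * m) then -1 else 1) *
        (1 - x ^ (((m : ℤ) : ZMod p) * (j : ZMod p)).valMinAbs.natAbs) := by
    rw [habs, hpow]
    split_ifs
    · rw [mul_sub, ← pow_add, Nat.sub_add_cancel (res_lt p _).le, hx]; ring
    · rfl
  have hsign : (legendreSym p m : R) =
      ∏ j ∈ Icc 1 ((p - 1) / 2), (if p < 2 * res p ((j : ℤ) * m) then (-1 : R) else 1) := by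
    rw [ZMod.gauss_lemma hp2 hm0, Finset.prod_ite, Finset.prod_const, Finset.prod_const_one,
      mul_one, hIcc]
    push_cast
    simp only [hhalf_lt, hres, Int.cast_natCast]
  have hperm : ∏ j ∈ Icc 1 ((p - 1) / 2),
      (1 - x ^ (((m : ℤ) : ZMod p) * (j : ZMod p)).valMinAbs.natAbs) =
      ∏ j ∈ Icc 1 ((p - 1) / 2), (1 - x ^ j) := by
    have h := congrArg (fun s => (s.map fun k => 1 - x ^ k).prod)
      (ZMod.Ico_map_valMinAbs_natAbs_eq_Ico_map_id p _ hm0)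
    rw [← hIcc] at h
    simpa only [Multiset.map_map, Function.comp_def, Finset.prod_eq_multiset_prod] using h
  rw [← Finset.prod_pow_eq_pow_sum, Rset, Finset.prod_filter, ← Finset.prod_mul_distrib,
    Finset.prod_congr rfl fun j _ => hfactor j, Finset.prod_mul_distrib, hsign, hperm]

theorem isCoprime_one_sub_X_pow_pqn (p : ℕ) [Fact p.Prime] {j : ℕ} (hj : 0 < j)
    (hjp : j < p) : IsCoprime (1 - X ^ j : ℚ[X]) (pqn X p) := by
  rw [pqn, ← cyclotomic_prime, ← neg_sub, IsCoprime.neg_left_iff,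
    ← prod_cyclotomic_eq_X_pow_sub_one hj]
  refine IsCoprime.prod_left fun d hd => cyclotomic.isCoprime_rat fun h => ?_
  exact absurd (Nat.divisor_le hd) (by omega)

theorem qCong_div_of_dvd {g N D : ℚ[X]} {b : ℤ} (hg : g ≠ 0) (hD : D ≠ 0)
    (hDg : IsCoprime D g) (h : g ∣ N - b * D) :
    qCong g (algebraMap ℚ[X] (RatFunc ℚ) N / algebraMap ℚ[X] (RatFunc ℚ) D) b := by
  obtain ⟨K, hK⟩ := h
  have hg' : algebraMap ℚ[X] (RatFunc ℚ) g ≠ 0 := RatFunc.algebraMap_ne_zero hg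
  have hD' : algebraMap ℚ[X] (RatFunc ℚ) D ≠ 0 := RatFunc.algebraMap_ne_zero hD
  have hK' := congrArg (algebraMap ℚ[X] (RatFunc ℚ)) hK
  simp only [map_sub, map_mul, map_intCast] at hK'
  have hquot : (algebraMap ℚ[X] (RatFunc ℚ) N / algebraMap ℚ[X] (RatFunc ℚ) D - b) /
      algebraMap ℚ[X] (RatFunc ℚ) g =
      algebraMap ℚ[X] (RatFunc ℚ) K / algebraMap ℚ[X] (RatFunc ℚ) D := by
    field_simp
    linear_combination hK'
  rw [qCong, hquot]
  exact hDg.of_isCoprime_of_dvd_left (RatFunc.denom_div_dvd K D)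

theorem q_euler_quotient_well_defined (p : ℕ) [Fact p.Prime] (hodd : Odd p)
    (m : ℕ) (hm : 1 ≤ m) (hpm : ¬ p ∣ m) :
    qCong (pqn Polynomial.X p)
      (q ^ (∑ j ∈ Rset p (m : ℤ), (p - res p ((j : ℤ) * m))) *
        (qpoch (q ^ m) (q ^ m) ((p - 1) / 2) / qpoch q q ((p - 1) / 2)))
      (legendreSym p m : RatFunc ℚ) := by
  set S := ∑ j ∈ Rset p (m : ℤ), (p - res p ((j : ℤ) * m))
  have hg : pqn (X : ℚ[X]) p ≠ 0 := by
    rw [pqn, ← cyclotomic_prime]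
    exact cyclotomic_ne_zero p ℚ
  have hD : IsCoprime (∏ j ∈ Icc 1 ((p - 1) / 2), (1 - X ^ j : ℚ[X])) (pqn X p) := by
    refine IsCoprime.prod_left fun j hj => ?_
    rw [mem_Icc] at hj
    exact isCoprime_one_sub_X_pow_pqn p (by omega) (by omega)
  have hD0 : (∏ j ∈ Icc 1 ((p - 1) / 2), (1 - X ^ j : ℚ[X])) ≠ 0 := by
    refine Finset.prod_ne_zero_iff.2 fun j hj => ?_
    rw [← neg_sub, neg_ne_zero]
    exact X_pow_sub_C_ne_zero (mem_Icc.1 hj).1 1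
  have hroot : AdjoinRoot.root (pqn (X : ℚ[X]) p) ^ p = 1 := by
    have h : AdjoinRoot.mk (pqn (X : ℚ[X]) p) (X ^ p - 1) = 0 := by
      rw [AdjoinRoot.mk_eq_zero, pqn, ← geom_sum_mul]
      exact dvd_mul_right _ _
    simpa [sub_eq_zero] using h
  have hdvd : pqn X p ∣ X ^ S * ∏ j ∈ Icc 1 ((p - 1) / 2), (1 - (X ^ m) ^ j : ℚ[X]) -
      (legendreSym p m : ℚ[X]) * ∏ j ∈ Icc 1 ((p - 1) / 2), (1 - X ^ j : ℚ[X]) := by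
    rw [← AdjoinRoot.mk_eq_zero, map_sub, sub_eq_zero]
    simpa [map_prod] using gauss_lemma_of_pow_eq_one p hodd m hpm _ hroot
  have hcong := qCong_div_of_dvd hg hD0 hD hdvd
  rw [qpoch_self, qpoch_self, ← mul_div_assoc]
  simpa [q, map_prod] using hcong
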